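/- arXiv:2410.23927 — 2 statements merged into one kernel-verified Lean document; each statement's English description precedes it below -/
import Mathlib

section
/- Let p ≥ 1 and let μ, ν ∈ P_p(ℝ) be atomless Borel probability measures on ℝ with finite p-th moment. Then the set of couplings of the form (T, Id)_# ν for one-to-one Borel maps T : ℝ → ℝ with T_# ν = μ is dense in the set Π(μ, ν) of all couplings of μ and ν with respect to the Wasserstein distance W_p on P_p(ℝ × ℝ). -/
open MeasureTheory ProbabilityTheory Filter Set
open scoped ENNReal NNReal Topology

noncomputable section

namespace Paper

abbrev Path (N : ℕ) := Fin N → ℝ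
abbrev PathPair (N : ℕ) := (Fin N → ℝ) × (Fin N → ℝ)

/-- the `p`-norm `(∑ |x i|^p)^{1/p}` on `ℝ^N`. -/
def pnorm (p : ℝ) {N : ℕ} (x : Fin N → ℝ) : ℝ := (∑ i : Fin N, |x i| ^ p) ^ (1 / p)

/-- the `p`-norm of the coordinates with index `≥ t`. -/
def pnormFrom (p : ℝ) {N : ℕ} (t : ℕ) (x : Path N) : ℝ :=
  (∑ i : Fin N, if t ≤ (i : ℕ) then |x i| ^ p else 0) ^ (1 / p)

/-- one-step `L^p` transport cost `C_p(π) = (∫ |x-y|^p dπ)^{1/p}` of a plan on `ℝ × ℝ`. -/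
def Cp (p : ℝ) (π : Measure (ℝ × ℝ)) : ℝ := (∫ z, |z.1 - z.2| ^ p ∂π) ^ (1 / p)

/-- `γ` is a coupling (transport plan) of `μ` and `ν`. -/
def IsCoupling {α β : Type*} [MeasurableSpace α] [MeasurableSpace β]
    (γ : Measure (α × β)) (μ : Measure α) (ν : Measure β) : Prop :=
  γ.map Prod.fst = μ ∧ γ.map Prod.snd = ν

/-- the `p`-Wasserstein distance between measures on `ℝ`. -/
def WpR (p : ℝ) (m₁ m₂ : Measure ℝ) : ℝ :=
  sInf { r | ∃ π : Measure (ℝ × ℝ), IsCoupling π m₁ m₂ ∧ r = Cp p π }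

/-- the `p`-Wasserstein distance on `ℝ^N` with the `p`-norm cost. -/
def Wp (p : ℝ) {N : ℕ} (μ ν : Measure (Path N)) : ℝ :=
  sInf { r | ∃ γ : Measure (PathPair N), IsCoupling γ μ ν ∧
    r = (∫ z, pnorm p (z.1 - z.2) ^ p ∂γ) ^ (1 / p) }

/-- the `p`-Wasserstein distance between measures on `ℝ × ℝ` (with the `p`-sum product cost). -/
def Wp2 (p : ℝ) (m₁ m₂ : Measure (ℝ × ℝ)) : ℝ :=
  sInf { r | ∃ Γ : Measure ((ℝ × ℝ) × (ℝ × ℝ)), IsCoupling Γ m₁ m₂ ∧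
    r = (∫ w, (|w.1.1 - w.2.1| ^ p + |w.1.2 - w.2.2| ^ p) ∂Γ) ^ (1 / p) }

/-- finite `p`-th moment. -/
def FiniteMomentP (p : ℝ) {N : ℕ} (μ : Measure (Path N)) : Prop :=
  Integrable (fun x => pnorm p x ^ p) μ

/-- truncation: keeps the first `t` coordinates of a path, zero elsewhere. -/
def trunc (N t : ℕ) (x : Path N) : Path N := fun i => if (i : ℕ) < t then x i else 0

/-- evaluation of the `t`-th coordinate (`0`-based). -/
def evalAt (N t : ℕ) (x : Path N) : ℝ := if h : t < N then x ⟨t, h⟩ else 0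

/-- update of the `t`-th coordinate (`0`-based). -/
def updAt (N t : ℕ) (x : Path N) (v : ℝ) : Path N := fun i => if (i : ℕ) = t then v else x i

/-- the canonical (regular) conditional kernel of a measure on a product space. -/
def condK {α Ω : Type*} [MeasurableSpace α] [MeasurableSpace Ω]
    [StandardBorelSpace Ω] [Nonempty Ω] (ρ : Measure (α × Ω)) : α → Measure Ω := by
  classical
  exact if h : IsFiniteMeasure ρ then (haveI := h; fun a => ρ.condKernel a) else fun _ => 0

/-- the one-step conditional (regular conditional distribution) kernel `x_{1:t} ↦ μ_{x_{1:t}}`. -/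
def stepK {N : ℕ} (μ : Measure (Path N)) (t : ℕ) : Path N → Measure ℝ :=
  condK (μ.map fun x => (trunc N t x, evalAt N t x))

/-- the conditional law of the whole path given the first `t` coordinates. -/
def condPath {N : ℕ} (μ : Measure (Path N)) (t : ℕ) : Path N → Measure (Path N) :=
  condK (μ.map fun x => (trunc N t x, x))

/-- the conditional law `μ̄_{x_{1:t}}` of the remaining coordinates `x_{t+1:N}`. -/
def tailLaw {N : ℕ} (μ : Measure (Path N)) (t : ℕ) : Path N → Measure (Fin (N - t) → ℝ) :=
  condK (μ.map fun x => (trunc N t x,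
    fun i : Fin (N - t) => x ⟨t + i.1, by have := i.isLt; omega⟩))

/-- the one-step conditional kernel of a coupling given `(x_{1:t}, y_{1:t})`. -/
def pairStepK {N : ℕ} (γ : Measure (PathPair N)) (t : ℕ) : PathPair N → Measure (ℝ × ℝ) :=
  condK (γ.map fun ω => ((trunc N t ω.1, trunc N t ω.2), (evalAt N t ω.1, evalAt N t ω.2)))

/-- Bicausality of a coupling of the laws of two `N`-step processes:
for every `t` and Borel `A`, `γ_{x_{1:N}}(y_{1:t} ∈ A) = γ_{x_{1:t}}(y_{1:t} ∈ A)`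
(expressed via conditional expectations), and symmetrically in `x` and `y`. -/
def Bicausal {N : ℕ} (γ : Measure (PathPair N)) : Prop :=
  ∀ t, t ≤ N → ∀ A : Set (Path N), MeasurableSet A →
    (γ[({ω : PathPair N | trunc N t ω.2 ∈ A}.indicator fun _ => (1 : ℝ)) |
        MeasurableSpace.comap Prod.fst inferInstance]
      =ᵐ[γ]
     γ[({ω : PathPair N | trunc N t ω.2 ∈ A}.indicator fun _ => (1 : ℝ)) |
        MeasurableSpace.comap (fun ω : PathPair N => trunc N t ω.1) inferInstance])
    ∧
    (γ[({ω : PathPair N | trunc N t ω.1 ∈ A}.indicator fun _ => (1 : ℝ)) |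
        MeasurableSpace.comap Prod.snd inferInstance]
      =ᵐ[γ]
     γ[({ω : PathPair N | trunc N t ω.1 ∈ A}.indicator fun _ => (1 : ℝ)) |
        MeasurableSpace.comap (fun ω : PathPair N => trunc N t ω.2) inferInstance])

/-- the adapted `p`-Wasserstein distance `AW_p`. -/
def AWp (p : ℝ) {N : ℕ} (μ ν : Measure (Path N)) : ℝ :=
  (sInf { r | ∃ γ : Measure (PathPair N), IsCoupling γ μ ν ∧ Bicausal γ ∧
      r = ∫ z, pnorm p (z.1 - z.2) ^ p ∂γ }) ^ (1 / p)

/-- peel off the first coordinates of a pair of paths. -/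
def peel (k : ℕ) (ω : PathPair (k + 1)) : (ℝ × ℝ) × PathPair k :=
  ((ω.1 0, ω.2 0), (fun i => ω.1 i.succ, fun i => ω.2 i.succ))

/-- the functional `F_{t,p}` (indexed by the number `k = N - t` of remaining steps):
`F_{N,p} = 0` and `F_{t,p}(γ) = C_p(γ^1) ⊔ ‖F_{t+1,p}(γ̄_{x_1,y_1})‖_{L^∞(γ^1)}`. -/
def Fadapt (p : ℝ) : (k : ℕ) → Measure (PathPair k) → ℝ
  | 0, _ => 0
  | (k + 1), γ =>
      max (Cp p ((γ.map (peel k)).map Prod.fst))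
        (essSup (fun c => Fadapt p k (condK (γ.map (peel k)) c)) ((γ.map (peel k)).map Prod.fst))

/-- the adapted `(p,∞)`-Wasserstein distance `AW_p^∞`. -/
def AWinf (p : ℝ) {N : ℕ} (μ ν : Measure (Path N)) : ℝ :=
  sInf { r | ∃ γ : Measure (PathPair N), IsCoupling γ μ ν ∧ Bicausal γ ∧ r = Fadapt p N γ }

/-- `μ` is successively `W_p`-continuous: `x_{1:t} ↦ μ_{x_{1:t}}` is continuous w.r.t. `W_p`. -/
def SuccWpCont (p : ℝ) {N : ℕ} (μ : Measure (Path N)) : Prop :=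
  ∀ t < N, ∀ (xs : ℕ → Path N) (x : Path N),
    Tendsto (fun n => trunc N t (xs n)) atTop (𝓝 (trunc N t x)) →
    Tendsto (fun n => WpR p (stepK μ t (trunc N t (xs n))) (stepK μ t (trunc N t x)))
      atTop (𝓝 0)

/-- the one-step ambiguity set `Π_δ(m, ·)`. -/
def PiStep (p δ : ℝ) (m : Measure ℝ) : Set (Measure (ℝ × ℝ)) :=
  { π | IsProbabilityMeasure π ∧ π.map Prod.fst = m ∧ Cp p π < δ }

/-- the closed one-step ambiguity set `Π̄_δ(m, ·)`. -/
def PiStepCl (p δ : ℝ) (m : Measure ℝ) : Set (Measure (ℝ × ℝ)) :=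
  { π | IsProbabilityMeasure π ∧ π.map Prod.fst = m ∧ Cp p π ≤ δ }

/-- the Monge (transport-map) subset `Π^T_δ(m, ·)`. -/
def PiStepT (p δ : ℝ) (m : Measure ℝ) : Set (Measure (ℝ × ℝ)) :=
  { π | π ∈ PiStep p δ m ∧ ∃ (ν : Measure ℝ) (T : ℝ → ℝ), IsProbabilityMeasure ν ∧
      Integrable (fun y => |y| ^ p) ν ∧ Measurable T ∧ π = ν.map fun y => (T y, y) }

/-- the martingale one-step ambiguity set `Π^M_δ(m, ·)`. -/
def PiStepM (p δ : ℝ) (m : Measure ℝ) : Set (Measure (ℝ × ℝ)) :=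
  { π | IsProbabilityMeasure π ∧ π.map Prod.fst = m ∧ Cp p π < δ ∧
      ∫ z, (z.1 - z.2) ∂π = 0 }

/-- membership in the multistep ambiguity set `Π_δ(m, ·)` from time `t₀` on: `γ` is a
concatenation of one-step kernels lying in the one-step ambiguity sets, i.e. the conditional
law of `(X_{s+1}, Y_{s+1})` given `(X_{1:s}, Y_{1:s})` has first marginal `m_{x_{1:s}}` and
one-step cost `< δ`, almost surely, for every `s ≥ t₀`. -/
def MemPiDeltaFrom {N : ℕ} (p δ : ℝ) (m : Measure (Path N)) (t₀ : ℕ)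
    (γ : Measure (PathPair N)) : Prop :=
  IsProbabilityMeasure γ ∧ γ.map Prod.fst = m ∧
  ∀ s, t₀ ≤ s → s < N → ∀ᵐ ω ∂γ,
    (pairStepK γ s (trunc N s ω.1, trunc N s ω.2)).map Prod.fst = stepK m s (trunc N s ω.1) ∧
    Cp p (pairStepK γ s (trunc N s ω.1, trunc N s ω.2)) < δ

/-- membership in `Π_δ(m, ·)`. -/
def MemPiDelta {N : ℕ} (p δ : ℝ) (m : Measure (Path N)) (γ : Measure (PathPair N)) : Prop :=
  MemPiDeltaFrom p δ m 0 γ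

/-- membership in the martingale multistep ambiguity set `Π^M_δ(m, ·)`. -/
def MemPiDeltaM {N : ℕ} (p δ : ℝ) (m : Measure (Path N)) (γ : Measure (PathPair N)) : Prop :=
  IsProbabilityMeasure γ ∧ γ.map Prod.fst = m ∧
  ∀ s < N, ∀ᵐ ω ∂γ,
    (pairStepK γ s (trunc N s ω.1, trunc N s ω.2)).map Prod.fst = stepK m s (trunc N s ω.1) ∧
    Cp p (pairStepK γ s (trunc N s ω.1, trunc N s ω.2)) < δ ∧
    ∫ z, (z.1 - z.2) ∂(pairStepK γ s (trunc N s ω.1, trunc N s ω.2)) = 0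

/-- predictable controls with values in `K^N`: `α_t` depends only on `(x_{1:t-1}, y_{1:t-1})`. -/
def Predictable {N : ℕ} (K : Set ℝ) (α : PathPair N → Path N) : Prop :=
  Measurable α ∧ (∀ ω i, α ω i ∈ K) ∧
  ∀ (i : Fin N) (ω ω' : PathPair N),
    trunc N i ω.1 = trunc N i ω'.1 → trunc N i ω.2 = trunc N i ω'.2 → α ω i = α ω' i

/-- predictable controls of a single path with values in `K^N`. -/
def PredictableX {N : ℕ} (K : Set ℝ) (β : Path N → Path N) : Prop :=
  Measurable β ∧ (∀ x i, β x i ∈ K) ∧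
  ∀ (i : Fin N) (x x' : Path N), trunc N i x = trunc N i x' → β x i = β x' i

/-- uncontrolled backward value recursion (indexed by the number `k = N - t` of remaining
steps); `V^δ_t(x_{1:t}, y_{1:t}) = Vu p δ κ f (N - t) x y`. -/
def Vu {N : ℕ} (p δ : ℝ) (κ : ℕ → Path N → Measure ℝ) (f : Path N → ℝ) :
    ℕ → Path N → Path N → ℝ
  | 0, _, y => f y
  | (k + 1), x, y =>
      sSup { s | ∃ γ ∈ PiStep p δ (κ (N - (k + 1)) (trunc N (N - (k + 1)) x)),
        s = ∫ z, Vu p δ κ f k (updAt N (N - (k + 1)) x z.1)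
            (updAt N (N - (k + 1)) y z.2) ∂γ }

/-- controlled backward value recursion. -/
def Vc {N : ℕ} (p δ : ℝ) (κ : ℕ → Path N → Measure ℝ) (K : Set ℝ)
    (f : Path N → Path N → ℝ) : ℕ → Path N → Path N → Path N → ℝ
  | 0, _, y, a => f y a
  | (k + 1), x, y, a =>
      sInf { r | ∃ c ∈ K, r =
        sSup { s | ∃ γ ∈ PiStep p δ (κ (N - (k + 1)) (trunc N (N - (k + 1)) x)),
          s = ∫ z, Vc p δ κ K f k (updAt N (N - (k + 1)) x z.1)
              (updAt N (N - (k + 1)) y z.2) (updAt N (N - (k + 1)) a c) ∂γ } }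

/-- controlled backward value recursion with Monge one-step plans. -/
def VcT {N : ℕ} (p δ : ℝ) (κ : ℕ → Path N → Measure ℝ) (K : Set ℝ)
    (f : Path N → Path N → ℝ) : ℕ → Path N → Path N → Path N → ℝ
  | 0, _, y, a => f y a
  | (k + 1), x, y, a =>
      sInf { r | ∃ c ∈ K, r =
        sSup { s | ∃ γ ∈ PiStepT p δ (κ (N - (k + 1)) (trunc N (N - (k + 1)) x)),
          s = ∫ z, VcT p δ κ K f k (updAt N (N - (k + 1)) x z.1)
              (updAt N (N - (k + 1)) y z.2) (updAt N (N - (k + 1)) a c) ∂γ } }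

/-- controlled backward value recursion with the martingale constraint. -/
def VcM {N : ℕ} (p δ : ℝ) (κ : ℕ → Path N → Measure ℝ) (K : Set ℝ)
    (f : Path N → Path N → ℝ) : ℕ → Path N → Path N → Path N → ℝ
  | 0, _, y, a => f y a
  | (k + 1), x, y, a =>
      sInf { r | ∃ c ∈ K, r =
        sSup { s | ∃ γ ∈ PiStepM p δ (κ (N - (k + 1)) (trunc N (N - (k + 1)) x)),
          s = ∫ z, VcM p δ κ K f k (updAt N (N - (k + 1)) x z.1)
              (updAt N (N - (k + 1)) y z.2) (updAt N (N - (k + 1)) a c) ∂γ } }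

/-- the distributionally robust control problem `V(δ)`. -/
def Vdro {N : ℕ} (p δ : ℝ) (μ : Measure (Path N)) (K : Set ℝ)
    (f : Path N → Path N → ℝ) : ℝ :=
  sInf { r | ∃ α : PathPair N → Path N, Predictable K α ∧
    r = sSup { s | ∃ γ : Measure (PathPair N), MemPiDelta p δ μ γ ∧ Bicausal γ ∧
        s = ∫ ω, f ω.2 (α ω) ∂γ } }

/-- the martingale-constrained distributionally robust control problem `V^M(δ)`. -/
def VdroM {N : ℕ} (p δ : ℝ) (μ : Measure (Path N)) (K : Set ℝ)
    (f : Path N → Path N → ℝ) : ℝ :=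
  sInf { r | ∃ α : PathPair N → Path N, Predictable K α ∧
    r = sSup { s | ∃ γ : Measure (PathPair N), MemPiDeltaM p δ μ γ ∧ Bicausal γ ∧
        s = ∫ ω, f ω.2 (α ω) ∂γ } }

/-- the non-robust value `V(0)`. -/
def V0 {N : ℕ} (μ : Measure (Path N)) (K : Set ℝ) (f : Path N → Path N → ℝ) : ℝ :=
  sInf { r | ∃ β : Path N → Path N, PredictableX K β ∧ r = ∫ x, f x (β x) ∂μ }

/-- the partial derivative `∂_s f(x, a)` in the `s`-th state coordinate (`0`-based). -/
def Dstate {N : ℕ} (f : Path N → Path N → ℝ) (s : ℕ) (x a : Path N) : ℝ :=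
  if h : s < N then fderiv ℝ (fun z => f z a) x (Pi.single (⟨s, h⟩ : Fin N) 1) else 0

/-- `x_{1:s+1} ↦ ∫ ∂_{s+1} f(z, β(z)) μ̄_{x_{1:s+1}}(dz)` (`1`-based index `t = s + 1`). -/
def Gfun {N : ℕ} (μ : Measure (Path N)) (f : Path N → Path N → ℝ)
    (β : Path N → Path N) (s : ℕ) (x : Path N) : ℝ :=
  ∫ z, Dstate f s z (β z) ∂(condPath μ (s + 1) (trunc N (s + 1) x))

/-- continuity of the cdf of an atomless probability measure. -/
lemma cdf_continuous_aux (ρ : Measure ℝ) [IsProbabilityMeasure ρ] (ha : ∀ x : ℝ, ρ {x} = 0) :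
    Continuous (cdf ρ) := by
  rw [continuous_iff_continuousAt]
  intro x
  rw [(monotone_cdf ρ).continuousAt_iff_leftLim_eq_rightLim, StieltjesFunction.rightLim_eq]
  have h := StieltjesFunction.measure_singleton (cdf ρ) x
  rw [measure_cdf, ha x] at h
  have h2 := ENNReal.ofReal_eq_zero.1 h.symm
  have h3 := (monotone_cdf ρ).leftLim_le (le_refl x)
  linarith

/-- probability integral transform. -/
lemma cdf_map_aux (ρ : Measure ℝ) [IsProbabilityMeasure ρ] (ha : ∀ x : ℝ, ρ {x} = 0) :
    ρ.map (cdf ρ) = (volume : Measure ℝ).restrict (Icc 0 1) := by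
  have hc := cdf_continuous_aux ρ ha
  have hm := monotone_cdf ρ
  haveI : IsProbabilityMeasure (ρ.map (cdf ρ)) :=
    Measure.isProbabilityMeasure_map hc.measurable.aemeasurable
  refine Measure.ext_of_Iic _ _ fun u => ?_
  rw [Measure.map_apply hc.measurable measurableSet_Iic, Measure.restrict_apply measurableSet_Iic]
  rcases lt_or_ge u 0 with hu | hu
  · have h1 : (cdf ρ) ⁻¹' Iic u = ∅ := by
      ext y
      have := cdf_nonneg ρ y
      simp only [mem_preimage, mem_Iic, mem_empty_iff_false, iff_false, not_le]
      linarith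
    have h2 : Iic u ∩ Icc (0 : ℝ) 1 = ∅ := by
      ext y
      simp only [mem_inter_iff, mem_Iic, mem_Icc, mem_empty_iff_false, iff_false]
      rintro ⟨h, h', -⟩
      linarith
    rw [h1, h2]; simp
  rcases le_or_gt 1 u with hu1 | hu1
  · have h1 : (cdf ρ) ⁻¹' Iic u = univ := by
      ext y
      have := cdf_le_one ρ y
      simp only [mem_preimage, mem_Iic, mem_univ, iff_true]
      linarith
    have h2 : Iic u ∩ Icc (0 : ℝ) 1 = Icc 0 1 := by
      ext y
      simp only [mem_inter_iff, mem_Iic, mem_Icc, and_iff_right_iff_imp]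
      rintro ⟨h, h'⟩
      linarith
    rw [h1, h2]; simp
  have h2 : Iic u ∩ Icc (0 : ℝ) 1 = Icc 0 u := by
    ext y
    simp only [mem_inter_iff, mem_Iic, mem_Icc]
    constructor
    · rintro ⟨h, h', -⟩; exact ⟨h', h⟩
    · rintro ⟨h, h'⟩; exact ⟨h', h, by linarith⟩
  rw [h2, Real.volume_Icc, sub_zero]
  set S := (cdf ρ) ⁻¹' Iic u with hS
  rcases S.eq_empty_or_nonempty with he | hne
  · have h0 : u ≤ 0 := by
      refine ge_of_tendsto' (tendsto_cdf_atBot ρ) fun y => ?_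
      by_contra hlt
      have : y ∈ S := by
        simp only [hS, mem_preimage, mem_Iic]; linarith
      rw [he] at this
      exact this
    rw [he, measure_empty, ENNReal.ofReal_of_nonpos h0]
  obtain ⟨b, hb⟩ := ((tendsto_cdf_atTop ρ).eventually (lt_mem_nhds hu1)).exists
  have hbdd : BddAbove S := by
    refine ⟨b, fun y hy => ?_⟩
    by_contra hlt
    have h3 := hm (not_le.1 hlt).le
    have h4 : cdf ρ y ≤ u := hy
    linarith
  have hcl : IsClosed S := isClosed_Iic.preimage hc
  have hmem : sSup S ∈ S := hcl.csSup_mem hne hbdd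
  have hSe : S = Iic (sSup S) := by
    ext y
    constructor
    · exact fun hy => le_csSup hbdd hy
    · intro hy
      exact le_trans (hm hy) hmem
  have hval : cdf ρ (sSup S) = u := by
    refine le_antisymm hmem ?_
    have ht : Tendsto (cdf ρ) (𝓝[>] (sSup S)) (𝓝 (cdf ρ (sSup S))) :=
      (hc.tendsto _).mono_left nhdsWithin_le_nhds
    refine ge_of_tendsto ht ?_
    filter_upwards [self_mem_nhdsWithin] with y hy
    by_contra hlt
    have : y ∈ S := by
      simp only [hS, mem_preimage, mem_Iic]; linarith
    exact absurd (le_csSup hbdd this) (not_le.2 hy)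
  rw [hSe, ← ofReal_cdf, hval]

/-- the cdf of an atomless measure takes each given value with probability zero. -/
lemma cdf_ne_aux (ρ : Measure ℝ) [IsProbabilityMeasure ρ] (ha : ∀ x : ℝ, ρ {x} = 0) (c : ℝ) :
    ∀ᵐ x ∂ρ, cdf ρ x ≠ c := by
  have hc := (cdf_continuous_aux ρ ha).measurable
  have h : ∀ᵐ t ∂(ρ.map (cdf ρ)), t ≠ c := by
    rw [cdf_map_aux ρ ha]
    exact ae_restrict_of_ae (Measure.ae_ne volume c)
  exact ae_of_ae_map hc.aemeasurable h

/-- an almost sure measurable left inverse of the cdf. -/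
lemma cdf_inv_aux (ρ : Measure ℝ) [IsProbabilityMeasure ρ] (ha : ∀ x : ℝ, ρ {x} = 0) :
    ∃ g : ℝ → ℝ, Measurable g ∧ ∀ᵐ x ∂ρ, g (cdf ρ x) = x := by
  have hc := (cdf_continuous_aux ρ ha).measurable
  have hm := monotone_cdf ρ
  set A : Set ℝ := {x | ∀ q : ℚ, cdf ρ x ≠ cdf ρ q} with hA
  have hAm : MeasurableSet A := by
    rw [hA, setOf_forall]
    exact MeasurableSet.iInter fun q => (measurableSet_eq_fun hc measurable_const).compl
  have hAe : ∀ᵐ x ∂ρ, x ∈ A := by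
    have : ∀ᵐ x ∂ρ, ∀ q : ℚ, cdf ρ x ≠ cdf ρ q :=
      ae_all_iff.2 fun q => cdf_ne_aux ρ ha _
    exact this
  have key : ∀ x ∈ A, ∀ y ∈ A, x < y → cdf ρ x ≠ cdf ρ y := by
    intro x hx y hy hxy he
    obtain ⟨q, h1, h2⟩ := exists_rat_btwn hxy
    exact hx q (le_antisymm (hm h1.le) (he ▸ hm h2.le))
  have hinj : Function.Injective (fun x : A => cdf ρ x) := by
    rintro ⟨x, hx⟩ ⟨y, hy⟩ he
    rcases lt_trichotomy x y with h | h | h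
    · exact absurd he (key x hx y hy h)
    · exact Subtype.ext h
    · exact absurd he.symm (key y hy x hx h)
  haveI := hAm.standardBorel
  have hemb : MeasurableEmbedding (fun x : A => cdf ρ x) :=
    (hc.comp measurable_subtype_coe).measurableEmbedding hinj
  obtain ⟨g, hg, hgc⟩ := hemb.exists_measurable_extend (g := fun x : A => (x : ℝ))
    measurable_subtype_coe (fun _ => ⟨(0 : ℝ)⟩)
  refine ⟨g, hg, ?_⟩
  filter_upwards [hAe] with x hx
  exact congr_fun hgc ⟨x, hx⟩

/-- an essentially injective random variable with the same law, close to the given one. -/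
lemma perturb_aux {Ω : Type*} [MeasurableSpace Ω] [StandardBorelSpace Ω] [Nonempty Ω]
    (P : Measure Ω) [IsProbabilityMeasure P] (X : Ω → ℝ) (hX : Measurable X)
    (ha : ∀ x : ℝ, (P.map X) {x} = 0) (δ : ℝ) (hδ : 0 < δ) :
    ∃ (Y : Ω → ℝ) (k : ℝ → Ω), Measurable Y ∧ Measurable k ∧ P.map Y = P.map X ∧
      (∀ᵐ ω ∂P, k (Y ω) = ω) ∧ ∀ᵐ ω ∂P, |Y ω - X ω| ≤ δ := by
  set μ := P.map X with hμ
  haveI : IsProbabilityMeasure μ := Measure.isProbabilityMeasure_map hX.aemeasurable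
  obtain ⟨e, he⟩ := exists_measurableEmbedding_real Ω
  set s : Ω → ℝ := fun ω => Real.sigmoid (e ω) with hs
  have hsm : Measurable s := Real.sigmoid_monotone.measurable.comp he.measurable
  set i : Ω → ℤ := fun ω => ⌊X ω / δ⌋ with hi
  have him : Measurable i := (hX.div_const δ).floor
  set h : Ω → ℝ := fun ω => (i ω : ℝ) + s ω with hh
  have hhm : Measurable h := by
    have : Measurable fun ω => (i ω : ℝ) := (measurable_of_countable _).comp him
    exact this.add hsm
  have hs0 : ∀ ω, 0 < s ω := fun ω => Real.sigmoid_pos _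
  have hs1 : ∀ ω, s ω < 1 := fun ω => Real.sigmoid_lt_one _
  have hfl : ∀ ω, ⌊h ω⌋ = i ω := by
    intro ω
    rw [Int.floor_eq_iff]
    constructor
    · simp only [hh]; linarith [hs0 ω]
    · simp only [hh]; linarith [hs1 ω]
  have hinj : Function.Injective h := by
    intro ω ω' hw
    have h1 : i ω = i ω' := by rw [← hfl, ← hfl, hw]
    have h2 : s ω = s ω' := by
      simp only [hh, h1] at hw
      linarith
    exact he.injective (Real.sigmoid_injective h2)
  have hemb : MeasurableEmbedding h := hhm.measurableEmbedding hinj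
  obtain ⟨hinv, hinvm, hinvc⟩ := hemb.exists_measurable_extend (g := fun ω : Ω => ω)
    measurable_id (fun _ => inferInstance)
  set ρ := P.map h with hρ
  haveI : IsProbabilityMeasure ρ := Measure.isProbabilityMeasure_map hhm.aemeasurable
  have hρa : ∀ x : ℝ, ρ {x} = 0 := by
    intro x
    rw [hρ, Measure.map_apply hhm (measurableSet_singleton x)]
    by_cases hx : ∃ ω, h ω = x
    · obtain ⟨ω, rfl⟩ := hx
      refine measure_mono_null (t := X ⁻¹' {X ω}) ?_ ?_
      · intro ω' hw
        have : ω' = ω := hinj hw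
        simp [this]
      · rw [← Measure.map_apply hX (measurableSet_singleton _)]
        exact ha _
    · have : h ⁻¹' {x} = ∅ := by
        ext ω
        simp only [mem_preimage, mem_singleton_iff, mem_empty_iff_false, iff_false]
        exact fun hw => hx ⟨ω, hw⟩
      rw [this, measure_empty]
  have hFρ := (cdf_continuous_aux ρ hρa).measurable
  have hFμ := (cdf_continuous_aux μ ha).measurable
  obtain ⟨gρ, hgρm, hgρ⟩ := cdf_inv_aux ρ hρa
  obtain ⟨gμ, hgμm, hgμ⟩ := cdf_inv_aux μ ha
  have hU : P.map (fun ω => cdf ρ (h ω)) = μ.map (cdf μ) := by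
    rw [cdf_map_aux μ ha, ← cdf_map_aux ρ hρa, hρ, Measure.map_map hFρ hhm]
    rfl
  have hFm : Measurable fun ω => cdf ρ (h ω) := hFρ.comp hhm
  -- the cdf of `μ` inverts `gμ` almost surely
  have hFg : ∀ᵐ ω ∂P, cdf μ (gμ (cdf ρ (h ω))) = cdf ρ (h ω) := by
    have h1 : ∀ᵐ t ∂(μ.map (cdf μ)), cdf μ (gμ t) = t := by
      refine (ae_map_iff hFμ.aemeasurable
        (measurableSet_eq_fun (hFμ.comp hgμm) measurable_id)).2 ?_
      filter_upwards [hgμ] with x hx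
      simp only [Function.comp, hx, id]
    rw [← hU] at h1
    exact ae_of_ae_map hFm.aemeasurable h1
  have hcell : ∀ z : ℤ, cdf ρ z = cdf μ (z * δ) := by
    intro z
    rw [cdf_eq_real, cdf_eq_real, measureReal_def, measureReal_def]
    congr 1
    rw [hρ, hμ, ← measure_congr (Iio_ae_eq_Iic' (hρa z)),
      ← measure_congr (Iio_ae_eq_Iic' (ha (z * δ))), Measure.map_apply hhm measurableSet_Iio,
      Measure.map_apply hX measurableSet_Iio]
    congr 1
    ext ω
    simp only [mem_preimage, mem_Iio]
    rw [← Int.floor_lt, hfl, Int.floor_lt, div_lt_iff₀ hδ]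
  refine ⟨fun ω => gμ (cdf ρ (h ω)), fun t => hinv (gρ (cdf μ t)), hgμm.comp hFm,
    hinvm.comp (hgρm.comp hFμ), ?_, ?_, ?_⟩
  · have h1 : P.map (fun ω => gμ (cdf ρ (h ω))) = (P.map (fun ω => cdf ρ (h ω))).map gμ := by
      rw [Measure.map_map hgμm hFm]; rfl
    rw [h1, hU, Measure.map_map hgμm hFμ]
    have h2 : (gμ ∘ cdf μ) =ᵐ[μ] id := hgμ
    rw [Measure.map_congr h2, Measure.map_id]
  · filter_upwards [hFg, ae_of_ae_map hhm.aemeasurable hgρ] with ω h1 h2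
    simp only [h1, h2]
    exact congr_fun hinvc ω
  · have hne : ∀ᵐ x ∂ρ, ∀ z : ℤ, cdf ρ x ≠ cdf ρ z := ae_all_iff.2 fun z => cdf_ne_aux ρ hρa _
    filter_upwards [hFg, ae_of_ae_map hhm.aemeasurable hne] with ω h1 h2
    have hl : cdf ρ (i ω) < cdf ρ (h ω) := by
      refine lt_of_le_of_ne (monotone_cdf ρ ?_) (h2 (i ω)).symm
      simp only [hh]; linarith [hs0 ω]
    have hr : cdf ρ (h ω) < cdf ρ ((i ω + 1 : ℤ) : ℝ) := by
      refine lt_of_le_of_ne (monotone_cdf ρ ?_) (h2 _)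
      simp only [hh]; push_cast; linarith [hs1 ω]
    rw [hcell, ← h1] at hl hr
    have hl' := (monotone_cdf μ).reflect_lt hl
    have hr' := (monotone_cdf μ).reflect_lt hr
    have e1 : (i ω : ℝ) * δ ≤ X ω := by
      rw [← le_div_iff₀ hδ]; exact Int.floor_le _
    have e2 : X ω ≤ ((i ω + 1 : ℤ) : ℝ) * δ := by
      rw [← div_le_iff₀ hδ]; push_cast; exact (Int.lt_floor_add_one _).le
    push_cast at hr' e2
    rw [abs_le]
    constructor <;> nlinarith

/-- a null set containing an injective Borel image of the real line. -/
lemma null_aux (μ : Measure ℝ) [IsProbabilityMeasure μ] :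
    ∃ (N : Set ℝ) (j : ℝ → ℝ), MeasurableSet N ∧ μ N = 0 ∧ Measurable j ∧
      Function.Injective j ∧ ∀ x, j x ∈ N := by
  have e : ℝ ≃ᵐ ℝ × ℝ := PolishSpace.measurableEquivOfNotCountable
    (not_countable_iff.2 inferInstance) (not_countable_iff.2 inferInstance)
  have hg : Measurable fun x => (e x).1 := measurable_fst.comp e.measurable
  have hc := Measure.countable_meas_level_set_pos (μ := μ) hg
  obtain ⟨t, ht⟩ : ∃ t, t ∉ {t : ℝ | 0 < μ {a : ℝ | (e a).1 = t}} := by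
    by_contra hcon
    push Not at hcon
    have : {t : ℝ | 0 < μ {a : ℝ | (e a).1 = t}} = univ := eq_univ_of_forall hcon
    rw [this] at hc
    exact not_countable_univ hc
  refine ⟨{a | (e a).1 = t}, fun x => e.symm (t, x), measurableSet_eq_fun hg measurable_const,
    by simpa using ht, e.symm.measurable.comp (measurable_const.prodMk measurable_id), ?_, ?_⟩
  · intro x y hxy
    have := e.symm.injective hxy
    simpa using this
  · intro x
    simp

/-- Lemma 6.3, density of one-to-one Monge plans: for atomless
`μ, ν ∈ P_p(ℝ)`, couplings of the form `(T, Id)_# ν` with `T` one-to-one and `T_# ν = μ` are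
dense in `Π(μ, ν)` for the Wasserstein distance `W_p` on `P_p(ℝ × ℝ)`. -/
theorem statement14 (p : ℝ) (hp : 1 ≤ p)
    (μ ν : Measure ℝ) (hμp : IsProbabilityMeasure μ) (hνp : IsProbabilityMeasure ν)
    (hμa : ∀ x : ℝ, μ {x} = 0) (hνa : ∀ x : ℝ, ν {x} = 0)
    (hμm : Integrable (fun x => |x| ^ p) μ) (hνm : Integrable (fun x => |x| ^ p) ν)
    (γ : Measure (ℝ × ℝ)) (hγ : IsCoupling γ μ ν) :
    ∀ ε > 0, ∃ T : ℝ → ℝ, Measurable T ∧ Function.Injective T ∧ ν.map T = μ ∧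
      Wp2 p (ν.map fun y => (T y, y)) γ < ε := by
  intro ε hε
  have hγ1 := hγ.1
  have hγ2 := hγ.2
  haveI hγp : IsProbabilityMeasure γ := by
    constructor
    have : (γ.map Prod.fst) univ = 1 := by rw [hγ1]; exact measure_univ
    rwa [Measure.map_apply measurable_fst MeasurableSet.univ, preimage_univ] at this
  obtain ⟨X, kX, hXm, hkX, hXl, hXi, hXd⟩ := perturb_aux γ Prod.fst measurable_fst
    (by rw [hγ1]; exact hμa) (ε / 3) (by positivity)
  obtain ⟨Y, kY, hYm, hkY, hYl, hYi, hYd⟩ := perturb_aux γ Prod.snd measurable_snd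
    (by rw [hγ2]; exact hνa) (ε / 3) (by positivity)
  rw [hγ1] at hXl
  rw [hγ2] at hYl
  obtain ⟨N, j, hNm, hN0, hjm, hji, hjN⟩ := null_aux μ
  set T0 : ℝ → ℝ := fun y => X (kY y) with hT0
  have hT0m : Measurable T0 := hXm.comp hkY
  set S0 : ℝ → ℝ := fun x => Y (kX x) with hS0
  have hS0m : Measurable S0 := hYm.comp hkX
  set A : Set ℝ := {y | S0 (T0 y) = y} ∩ T0 ⁻¹' Nᶜ with hA
  have hAm : MeasurableSet A :=
    (measurableSet_eq_fun (hS0m.comp hT0m) measurable_id).inter (hT0m hNm.compl)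
  classical
  set T : ℝ → ℝ := A.piecewise T0 j with hT
  have hTm : Measurable T := hT0m.piecewise hAm hjm
  -- along `Y` the map `T` is `X`
  have hXN : ∀ᵐ ω ∂γ, X ω ∉ N := by
    have : ∀ᵐ x ∂μ, x ∉ N := measure_eq_zero_iff_ae_notMem.1 hN0
    rw [← hXl] at this
    exact ae_of_ae_map hXm.aemeasurable this
  have hTY : ∀ᵐ ω ∂γ, T (Y ω) = X ω := by
    filter_upwards [hXi, hYi, hXN] with ω h1 h2 h3
    have h4 : T0 (Y ω) = X ω := by simp only [hT0, h2]
    have h5 : Y ω ∈ A := by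
      refine ⟨?_, ?_⟩
      · simp only [mem_setOf_eq, h4, hS0, h1]
      · simpa only [mem_preimage, h4, mem_compl_iff] using h3
    rw [hT, piecewise_eq_of_mem _ _ _ h5, h4]
  refine ⟨T, hTm, ?_, ?_, ?_⟩
  · intro y y' hyy
    by_cases h1 : y ∈ A <;> by_cases h2 : y' ∈ A
    · rw [hT, piecewise_eq_of_mem _ _ _ h1, piecewise_eq_of_mem _ _ _ h2] at hyy
      have e1 : S0 (T0 y) = y := h1.1
      have e2 : S0 (T0 y') = y' := h2.1
      rw [← e1, ← e2, hyy]
    · rw [hT, piecewise_eq_of_mem _ _ _ h1, piecewise_eq_of_notMem _ _ _ h2] at hyy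
      exact absurd (hyy ▸ hjN y') h1.2
    · rw [hT, piecewise_eq_of_notMem _ _ _ h1, piecewise_eq_of_mem _ _ _ h2] at hyy
      exact absurd (hyy ▸ hjN y) h2.2
    · rw [hT, piecewise_eq_of_notMem _ _ _ h1, piecewise_eq_of_notMem _ _ _ h2] at hyy
      exact hji hyy
  · rw [← hYl, Measure.map_map hTm hYm, ← hXl]
    exact Measure.map_congr hTY
  · have hlaw : (ν.map fun y => (T y, y)) = γ.map fun ω => (X ω, Y ω) := by
      rw [← hYl, Measure.map_map (g := fun y => (T y, y)) (hTm.prodMk measurable_id) hYm]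
      refine Measure.map_congr ?_
      filter_upwards [hTY] with ω h1
      simp only [Function.comp, h1]
    rw [hlaw]
    have hp0 : 0 < p := by linarith
    have hGm : Measurable fun ω : ℝ × ℝ => ((X ω, Y ω), ω) :=
      (hXm.prodMk hYm).prodMk measurable_id
    refine lt_of_le_of_lt (csInf_le ?_ ⟨γ.map fun ω => ((X ω, Y ω), ω), ⟨?_, ?_⟩, rfl⟩) ?_
    · refine ⟨0, ?_⟩
      rintro r ⟨Γ, -, rfl⟩
      exact Real.rpow_nonneg (integral_nonneg fun w => by positivity) _
    · rw [Measure.map_map measurable_fst hGm]; rfl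
    · rw [Measure.map_map measurable_snd hGm]
      exact Measure.map_id
    · have hcm : Measurable fun w : (ℝ × ℝ) × (ℝ × ℝ) =>
          |w.1.1 - w.2.1| ^ p + |w.1.2 - w.2.2| ^ p := by fun_prop
      rw [integral_map hGm.aemeasurable hcm.aestronglyMeasurable]
      have hb : ∫ ω, (|X ω - ω.1| ^ p + |Y ω - ω.2| ^ p) ∂γ ≤ 2 * (ε / 3) ^ p := by
        have h1 : ∀ᵐ ω ∂γ, ‖|X ω - ω.1| ^ p + |Y ω - ω.2| ^ p‖ ≤ 2 * (ε / 3) ^ p := by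
          filter_upwards [hXd, hYd] with ω h1 h2
          rw [Real.norm_of_nonneg (by positivity)]
          have e1 := Real.rpow_le_rpow (abs_nonneg _) h1 hp0.le
          have e2 := Real.rpow_le_rpow (abs_nonneg _) h2 hp0.le
          linarith
        have h2 := norm_integral_le_of_norm_le_const h1
        rw [probReal_univ, mul_one] at h2
        exact le_trans (le_abs_self _) h2
      have h0 : 0 ≤ ∫ ω, (|X ω - ω.1| ^ p + |Y ω - ω.2| ^ p) ∂γ :=
        integral_nonneg fun w => by positivity
      calc (∫ ω, (|X ω - ω.1| ^ p + |Y ω - ω.2| ^ p) ∂γ) ^ (1 / p)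
          ≤ (2 * (ε / 3) ^ p) ^ (1 / p) := Real.rpow_le_rpow h0 hb (by positivity)
        _ = 2 ^ (1 / p) * (ε / 3) := by
            rw [Real.mul_rpow (by norm_num) (by positivity), ← Real.rpow_mul (by positivity),
              mul_one_div_cancel hp0.ne', Real.rpow_one]
        _ ≤ 2 * (ε / 3) := by
            have : (2 : ℝ) ^ (1 / p) ≤ 2 ^ (1 : ℝ) :=
              Real.rpow_le_rpow_of_exponent_le (by norm_num) (by
                rw [div_le_one hp0]; exact hp)
            rw [Real.rpow_one] at this
            gcongr
        _ < ε := by linarith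
end Paper
end
end

section
/- Let p ≥ 1 and let η, ν ∈ P_p(ℝ) with ν atomless. Then the set of 'Monge from the second marginal' couplings { (T, Id)_# ν : T : ℝ → ℝ Borel measurable with T_# ν = η } is dense in Π(η, ν), the set of all couplings with first marginal η and second marginal ν, with respect to the Wasserstein distance W_p on P_p(ℝ × ℝ). -/
open MeasureTheory ProbabilityTheory Filter Set
open scoped ENNReal NNReal Topology

noncomputable section

namespace Paper

lemma uniform_cdf (μ : Measure ℝ) [IsProbabilityMeasure μ] (hμ : ∀ x, μ {x} = 0) :
    μ.map (fun y => (⟨cdf μ y, cdf_nonneg μ y, cdf_le_one μ y⟩ : unitInterval)) = volume := by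
  have hmono := monotone_cdf μ
  have hcont : Continuous (cdf μ) := by
    rw [continuous_iff_continuousAt]
    intro x
    rw [hmono.continuousAt_iff_leftLim_eq_rightLim]
    have h1 := (cdf μ).measure_singleton x
    rw [measure_cdf, hμ x] at h1
    have h2 := ENNReal.ofReal_eq_zero.1 h1.symm
    rw [(cdf μ).rightLim_eq x]
    exact le_antisymm (hmono.leftLim_le le_rfl) (by linarith)
  have hivt : ∀ t : ℝ, 0 < t → t < 1 → ∃ x, cdf μ x = t := by
    intro t h0 h1
    obtain ⟨a, ha⟩ := ((tendsto_cdf_atBot μ).eventually (gt_mem_nhds h0)).exists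
    obtain ⟨b, hb⟩ := ((tendsto_cdf_atTop μ).eventually (lt_mem_nhds h1)).exists
    exact mem_range_of_exists_le_of_exists_ge hcont ⟨a, ha.le⟩ ⟨b, hb.le⟩
  have hmeas : Measurable
      (fun y => (⟨cdf μ y, cdf_nonneg μ y, cdf_le_one μ y⟩ : unitInterval)) :=
    hcont.measurable.subtype_mk
  have : IsProbabilityMeasure (μ.map
      (fun y => (⟨cdf μ y, cdf_nonneg μ y, cdf_le_one μ y⟩ : unitInterval))) :=
    Measure.isProbabilityMeasure_map hmeas.aemeasurable
  refine Measure.ext_of_Iic _ _ fun t => ?_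
  rw [Measure.map_apply hmeas measurableSet_Iic, unitInterval.volume_Iic]
  have hset : (fun y => (⟨cdf μ y, cdf_nonneg μ y, cdf_le_one μ y⟩ : unitInterval)) ⁻¹' Iic t
      = {y | cdf μ y ≤ t} := by
    ext y; simp [← Subtype.coe_le_coe]
  rw [hset]
  obtain ⟨t, ht0, ht1⟩ := t
  simp only
  apply le_antisymm
  · rcases ht1.lt_or_eq with h | h
    · have key : ∀ s, t < s → s < 1 → μ {y | cdf μ y ≤ t} ≤ ENNReal.ofReal s := by
        intro s hs hs1
        obtain ⟨x, hx⟩ := hivt s (by linarith) hs1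
        rw [← hx, ofReal_cdf]
        refine measure_mono fun y hy => ?_
        by_contra hc
        have := hmono (not_le.1 hc).le
        replace hy : cdf μ y ≤ t := hy
        linarith
      have h2 : μ.real {y | cdf μ y ≤ t} ≤ t := by
        apply le_of_forall_gt_imp_ge_of_dense
        intro s hs
        have h3 := key (min s ((t+1)/2)) (lt_min hs (by linarith))
          ((min_le_right _ _).trans_lt (by linarith))
        have h4 := ENNReal.toReal_le_of_le_ofReal (le_min (ht0.trans hs.le) (by linarith)) h3
        exact h4.trans (min_le_left _ _)
      rw [← ENNReal.ofReal_toReal (measure_ne_top μ {y | cdf μ y ≤ t})]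
      exact ENNReal.ofReal_le_ofReal h2
    · subst h; simpa using prob_le_one
  · rcases ht0.lt_or_eq with h0 | h0
    · rcases ht1.lt_or_eq with h1 | h1
      · obtain ⟨x, hx⟩ := hivt t h0 h1
        have := ofReal_cdf μ x
        rw [hx] at this
        rw [this]
        exact measure_mono fun y hy => (hmono hy).trans hx.le
      · subst h1
        have : {y | cdf μ y ≤ (1 : ℝ)} = univ := by ext y; simp [cdf_le_one]
        rw [this]; simp
    · subst h0; simp

lemma exists_map_prob (μ η : Measure ℝ) [IsProbabilityMeasure μ] [IsProbabilityMeasure η]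
    (hμ : ∀ x, μ {x} = 0) : ∃ T : ℝ → ℝ, Measurable T ∧ μ.map T = η := by
  obtain ⟨f, hf, hfe⟩ := Kernel.exists_measurable_map_eq_unitInterval (Kernel.const Unit η)
  have hmeas : Measurable
      (fun y => (⟨cdf μ y, cdf_nonneg μ y, cdf_le_one μ y⟩ : unitInterval)) :=
    (monotone_cdf μ).measurable.subtype_mk
  refine ⟨fun y => f () ⟨cdf μ y, cdf_nonneg μ y, cdf_le_one μ y⟩,
    (hf.of_uncurry_left).comp hmeas, ?_⟩
  have h := hfe ()
  rw [← uniform_cdf μ hμ, Measure.map_map hf.of_uncurry_left hmeas] at h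
  simpa using! h

lemma exists_map_finite (μ η : Measure ℝ) [IsFiniteMeasure μ]
    (hμ : ∀ x, μ {x} = 0) (h : μ univ = η univ) : ∃ T : ℝ → ℝ, Measurable T ∧ μ.map T = η := by
  by_cases h0 : μ univ = 0
  · refine ⟨fun _ => 0, measurable_const, ?_⟩
    rw [Measure.measure_univ_eq_zero.1 h0, Measure.measure_univ_eq_zero.1 (h.symm.trans h0)]
    simp
  · have ht : μ univ ≠ ∞ := measure_ne_top _ _
    have i1 : IsProbabilityMeasure ((μ univ)⁻¹ • μ) :=
      ⟨by simp [ENNReal.inv_mul_cancel h0 ht]⟩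
    have i2 : IsProbabilityMeasure ((μ univ)⁻¹ • η) :=
      ⟨by simp [← h, ENNReal.inv_mul_cancel h0 ht]⟩
    obtain ⟨T, hT, hTe⟩ := exists_map_prob ((μ univ)⁻¹ • μ) ((μ univ)⁻¹ • η) (by simp [hμ])
    refine ⟨T, hT, ?_⟩
    rw [Measure.map_smul] at hTe
    have := congrArg (fun m => (μ univ) • m) hTe
    simpa [smul_smul, ENNReal.mul_inv_cancel h0 ht] using this

/-- Monge map realizing a prescribed joint law of `(T, f)` with `f` integer valued. -/
lemma exists_joint (ν : Measure ℝ) [IsFiniteMeasure ν] (hν : ∀ x, ν {x} = 0)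
    (π : Measure (ℝ × ℝ)) (hπ : π.map Prod.snd = ν) (f : ℝ → ℤ) (hf : Measurable f) :
    ∃ T : ℝ → ℝ, Measurable T ∧
      ν.map (fun y => (T y, f y)) = π.map (fun z => (z.1, f z.2)) := by
  have hk : ∀ k : ℤ, ∃ T : ℝ → ℝ, Measurable T ∧ (ν.restrict (f ⁻¹' {k})).map T
      = (π.restrict (Prod.snd ⁻¹' (f ⁻¹' {k}))).map Prod.fst := by
    intro k
    have hm : MeasurableSet (f ⁻¹' {k}) := hf (measurableSet_singleton k)
    apply exists_map_finite
    · intro x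
      exact le_antisymm ((Measure.restrict_apply_le _ _).trans (hν x).le) bot_le
    · rw [Measure.map_apply measurable_fst .univ, preimage_univ, Measure.restrict_apply_univ,
        Measure.restrict_apply_univ, ← hπ, Measure.map_apply measurable_snd hm]
  choose T hT hTe using hk
  have hTm : Measurable (fun y => T (f y) y) := by
    have : Measurable (fun q : ℤ × ℝ => T q.1 q.2) := measurable_from_prod_countable_right hT
    exact this.comp (hf.prodMk measurable_id)
  refine ⟨fun y => T (f y) y, hTm, ?_⟩
  have hg : Measurable (fun y => (T (f y) y, f y)) := hTm.prodMk hf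
  have hg2 : Measurable (fun z : ℝ × ℝ => (z.1, f z.2)) :=
    measurable_fst.prodMk (hf.comp measurable_snd)
  refine Measure.ext_of_iUnion_eq_univ (s := fun k : ℤ => Prod.snd ⁻¹' {k}) ?_ fun k => ?_
  · ext x; simp
  · ext s hs
    have hm : MeasurableSet (f ⁻¹' {k}) := hf (measurableSet_singleton k)
    have hsk : MeasurableSet ((fun x : ℝ => (x, k)) ⁻¹' s) := measurable_prodMk_right hs
    have hmk : MeasurableSet (Prod.snd ⁻¹' {k} : Set (ℝ × ℤ)) :=
      measurable_snd (measurableSet_singleton k)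
    rw [Measure.restrict_apply hs, Measure.restrict_apply hs,
      Measure.map_apply hg (hs.inter hmk), Measure.map_apply hg2 (hs.inter hmk)]
    have h := congrArg (fun m => m ((fun x : ℝ => (x, k)) ⁻¹' s)) (hTe k)
    rw [Measure.map_apply (hT k) hsk, Measure.map_apply measurable_fst hsk,
      Measure.restrict_apply (hT k hsk), Measure.restrict_apply (measurable_fst hsk)] at h
    convert h using 2
    · ext y
      simp only [mem_preimage, mem_inter_iff, mem_singleton_iff]
      constructor <;> (rintro ⟨h1, h2⟩; subst h2; exact ⟨h1, rfl⟩)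
    · ext y
      simp only [mem_preimage, mem_inter_iff, mem_singleton_iff]
      constructor <;> (rintro ⟨h1, h2⟩; subst h2; exact ⟨h1, rfl⟩)

/-- Gluing along a common image. -/
lemma exists_glue (ρ₁ ρ₂ : Measure (ℝ × ℝ)) [IsProbabilityMeasure ρ₁] [IsProbabilityMeasure ρ₂]
    (g : ℝ × ℝ → ℝ × ℤ) (hg : Measurable g) (h : ρ₁.map g = ρ₂.map g) :
    ∃ Γ : Measure ((ℝ × ℝ) × (ℝ × ℝ)), IsCoupling Γ ρ₁ ρ₂ ∧ ∀ᵐ w ∂Γ, g w.1 = g w.2 := by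
  set κ₁ := condDistrib id g ρ₁
  set κ₂ := condDistrib id g ρ₂
  set m := ρ₁.map g with hm
  have : IsProbabilityMeasure m := Measure.isProbabilityMeasure_map hg.aemeasurable
  have e1 : m ⊗ₘ κ₁ = ρ₁.map (fun a => (g a, a)) :=
    compProd_map_condDistrib (X := g) (Y := id) aemeasurable_id
  have e2 : m ⊗ₘ κ₂ = ρ₂.map (fun a => (g a, a)) := by
    rw [h]; exact compProd_map_condDistrib (X := g) (Y := id) aemeasurable_id
  set Γ' := m ⊗ₘ (κ₁ ×ₖ κ₂)
  have hgm : Measurable (fun a => (g a, a)) := hg.prodMk measurable_id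
  have f1 : Γ'.map (fun q => (q.1, q.2.1)) = m ⊗ₘ κ₁ := by
    have := Measure.compProd_map (μ := m) (κ := κ₁ ×ₖ κ₂) (f := Prod.fst) measurable_fst
    rw [← Kernel.fst_eq, Kernel.fst_prod] at this
    exact this.symm
  have f2 : Γ'.map (fun q => (q.1, q.2.2)) = m ⊗ₘ κ₂ := by
    have := Measure.compProd_map (μ := m) (κ := κ₁ ×ₖ κ₂) (f := Prod.snd) measurable_snd
    rw [← Kernel.snd_eq, Kernel.snd_prod] at this
    exact this.symm
  rw [e1] at f1
  rw [e2] at f2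
  have hE : MeasurableSet {q : (ℝ × ℤ) × (ℝ × ℝ) | g q.2 = q.1} :=
    measurableSet_eq_fun (hg.comp measurable_snd) measurable_fst
  have a1 : ∀ᵐ q ∂Γ', g q.2.1 = q.1 := by
    have : ∀ᵐ q ∂(Γ'.map (fun q => (q.1, q.2.1))), g q.2 = q.1 := by
      rw [f1, ae_map_iff hgm.aemeasurable hE]; simp
    exact ae_of_ae_map (f := fun q : (ℝ × ℤ) × ((ℝ × ℝ) × (ℝ × ℝ)) => (q.1, q.2.1))
      (by fun_prop) this
  have a2 : ∀ᵐ q ∂Γ', g q.2.2 = q.1 := by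
    have : ∀ᵐ q ∂(Γ'.map (fun q => (q.1, q.2.2))), g q.2 = q.1 := by
      rw [f2, ae_map_iff hgm.aemeasurable hE]; simp
    exact ae_of_ae_map (f := fun q : (ℝ × ℤ) × ((ℝ × ℝ) × (ℝ × ℝ)) => (q.1, q.2.2))
      (by fun_prop) this
  refine ⟨Γ'.map Prod.snd, ⟨?_, ?_⟩, ?_⟩
  · have := congrArg (fun m => m.map Prod.snd) f1
    rw [Measure.map_map measurable_snd (by fun_prop), Measure.map_map measurable_snd hgm] at this
    rw [Measure.map_map measurable_fst measurable_snd]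
    refine Eq.trans this ?_
    exact Measure.map_id
  · have := congrArg (fun m => m.map Prod.snd) f2
    rw [Measure.map_map measurable_snd (by fun_prop), Measure.map_map measurable_snd hgm] at this
    rw [Measure.map_map measurable_snd measurable_snd]
    refine Eq.trans this ?_
    exact Measure.map_id
  · refine (ae_map_iff measurable_snd.aemeasurable
      (measurableSet_eq_fun (hg.comp measurable_fst) (hg.comp measurable_snd))).2 ?_
    filter_upwards [a1, a2] with q h1 h2
    exact h1.trans h2.symm

/-- Lemma 6.4, density of Monge plans from the second marginal: for
`η, ν ∈ P_p(ℝ)` with `ν` atomless, couplings `(T, Id)_# ν` with `T_# ν = η` are dense in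
`Π(η, ν)` for the Wasserstein distance `W_p` on `P_p(ℝ × ℝ)`. -/
theorem statement15 (p : ℝ) (hp : 1 ≤ p)
    (η ν : Measure ℝ) (hηp : IsProbabilityMeasure η) (hνp : IsProbabilityMeasure ν)
    (hνa : ∀ x : ℝ, ν {x} = 0)
    (hηm : Integrable (fun x => |x| ^ p) η) (hνm : Integrable (fun x => |x| ^ p) ν)
    (π : Measure (ℝ × ℝ)) (hπ : IsCoupling π η ν) :
    ∀ ε > 0, ∃ T : ℝ → ℝ, Measurable T ∧ ν.map T = η ∧
      Wp2 p (ν.map fun y => (T y, y)) π < ε := by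
  intro ε hε
  have hp0 : 0 < p := by linarith
  have hπp : IsProbabilityMeasure π := by
    constructor
    have := congrArg (fun m => m univ) hπ.1
    simp only [Measure.map_apply measurable_fst MeasurableSet.univ, preimage_univ] at this
    rw [this]; exact measure_univ
  set δ := ε / 2 with hδ
  have hδ0 : 0 < δ := by positivity
  let f : ℝ → ℤ := fun y => ⌊y / δ⌋
  have hf : Measurable f := Int.measurable_floor.comp (measurable_id.div_const δ)
  obtain ⟨T, hT, hTe⟩ := exists_joint ν hνa π hπ.2 f hf
  have hTf : Measurable (fun y => (T y, f y)) := hT.prodMk hf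
  have hg : Measurable (fun z : ℝ × ℝ => (z.1, f z.2)) :=
    measurable_fst.prodMk (hf.comp measurable_snd)
  have hTi : Measurable (fun y => (T y, y)) := hT.prodMk measurable_id
  refine ⟨T, hT, ?_, ?_⟩
  · have := congrArg (fun m => m.map Prod.fst) hTe
    rw [Measure.map_map measurable_fst hTf, Measure.map_map measurable_fst hg] at this
    exact this.trans hπ.1
  · have : IsProbabilityMeasure (ν.map fun y => (T y, y)) :=
      Measure.isProbabilityMeasure_map hTi.aemeasurable
    obtain ⟨Γ, hΓ, hae⟩ := exists_glue (ν.map fun y => (T y, y)) π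
      (fun z => (z.1, f z.2)) hg (by rw [Measure.map_map hg hTi]; exact hTe)
    have hΓp : IsProbabilityMeasure Γ := by
      constructor
      have := congrArg (fun m => m univ) hΓ.2
      simp only [Measure.map_apply measurable_snd MeasurableSet.univ, preimage_univ] at this
      rw [this]; exact measure_univ
    have hle : Wp2 p (ν.map fun y => (T y, y)) π
        ≤ (∫ w, (|w.1.1 - w.2.1| ^ p + |w.1.2 - w.2.2| ^ p) ∂Γ) ^ (1 / p) := by
      refine csInf_le ⟨0, ?_⟩ ⟨Γ, hΓ, rfl⟩
      rintro r ⟨Γ', -, rfl⟩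
      exact Real.rpow_nonneg (integral_nonneg fun w => by positivity) _
    have hint : ∫ w, (|w.1.1 - w.2.1| ^ p + |w.1.2 - w.2.2| ^ p) ∂Γ ≤ δ ^ p := by
      have h1 : ∫ w, (|w.1.1 - w.2.1| ^ p + |w.1.2 - w.2.2| ^ p) ∂Γ ≤ ∫ w, δ ^ p ∂Γ := by
        refine integral_mono_of_nonneg (ae_of_all _ fun w => by positivity)
          (integrable_const _) ?_
        filter_upwards [hae] with w hw
        simp only [Prod.mk.injEq] at hw
        obtain ⟨hw1, hw2⟩ := hw
        rw [hw1, sub_self, abs_zero, Real.zero_rpow hp0.ne', zero_add]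
        refine Real.rpow_le_rpow (abs_nonneg _) ?_ hp0.le
        have h3 := Int.abs_sub_lt_one_of_floor_eq_floor hw2
        rw [← sub_div, abs_div, abs_of_pos hδ0, div_lt_one hδ0] at h3
        exact h3.le
      simpa using h1
    have h2 : (∫ w, (|w.1.1 - w.2.1| ^ p + |w.1.2 - w.2.2| ^ p) ∂Γ) ^ (1 / p) ≤ δ := by
      refine (Real.rpow_le_rpow (integral_nonneg fun w => by positivity) hint
        (by positivity)).trans ?_
      rw [← Real.rpow_mul hδ0.le, mul_one_div_cancel hp0.ne', Real.rpow_one]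
    linarith
end Paper
end
end
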